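/- arXiv:2204.04326 — 2 statements merged into one kernel-verified Lean document; each statement's English description precedes it below -/
import Mathlib

section
/- For every nonnegative integer k there exists a constant c_k > 0 such that for all λ > 0 and all real x, y, the 2k-th derivative in x of the heat kernel satisfies |∂_x^{2k} p_B(λ; x, y)| ≤ c_k · λ^{−k} · p_B(2λ; x, y). -/
open Real MeasureTheory Set

/-- One-dimensional heat kernel `p_B(τ; z, z') = (2πτ)^{-1/2} exp(-(z-z')²/(2τ))`. -/
noncomputable def pB (τ z z' : ℝ) : ℝ :=
  Real.exp (-(z - z') ^ 2 / (2 * τ)) / Real.sqrt (2 * Real.pi * τ)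

/-- A polynomial with integer coefficients is dominated on the reals by a constant multiple of `exp (u ^ 2 / 4)`. -/
theorem exists_abs_aeval_le_mul_exp_sq_div_four (p : Polynomial ℤ) :
    ∃ C > 0, ∀ u : ℝ, |Polynomial.aeval u p| ≤ C * Real.exp (u ^ 2 / 4) := by
  induction p using Polynomial.induction_on' with
  | add p q hp hq =>
    obtain ⟨C, hC, hp⟩ := hp
    obtain ⟨D, hD, hq⟩ := hq
    refine ⟨C + D, by positivity, fun u => ?_⟩
    rw [map_add, add_mul]
    exact (abs_add_le _ _).trans (add_le_add (hp u) (hq u))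
  | monomial n a =>
    refine ⟨(|(a : ℝ)| + 1) * (n.factorial * Real.exp 1), by positivity, fun u => ?_⟩
    have h1 : |u| ^ n / n.factorial ≤ Real.exp |u| :=
      Real.pow_div_factorial_le_exp _ (abs_nonneg u) n
    have h2 : Real.exp |u| ≤ Real.exp 1 * Real.exp (u ^ 2 / 4) := by
      rw [← Real.exp_add, Real.exp_le_exp]
      nlinarith [sq_nonneg (|u| - 2), sq_abs u]
    have h3 : |u| ^ n ≤ n.factorial * (Real.exp 1 * Real.exp (u ^ 2 / 4)) :=
      (div_le_iff₀' (by positivity)).1 (h1.trans h2)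
    simp only [Polynomial.aeval_monomial, eq_intCast, abs_mul, abs_pow]
    calc |(a : ℝ)| * |u| ^ n
        ≤ (|(a : ℝ)| + 1) * (n.factorial * (Real.exp 1 * Real.exp (u ^ 2 / 4))) := by
          gcongr
          linarith
      _ = _ := by ring

/-- The heat kernel is a rescaled and translated standard Gaussian. -/
theorem pB_eq_gaussian {l : ℝ} (hl : 0 < l) (x y : ℝ) :
    pB l x y = (Real.sqrt (2 * Real.pi * l))⁻¹ *
      Real.exp (-(((Real.sqrt l)⁻¹ * (x - y)) ^ 2 / 2)) := by
  rw [pB, div_eq_inv_mul, mul_pow, inv_pow, Real.sq_sqrt hl.le]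
  congr 2
  field_simp

/-- The derivatives of the heat kernel in terms of Hermite polynomials. -/
theorem iteratedDeriv_pB {l : ℝ} (hl : 0 < l) (n : ℕ) (x y : ℝ) :
    iteratedDeriv n (fun x => pB l x y) x =
      (Real.sqrt (2 * Real.pi * l))⁻¹ * ((Real.sqrt l)⁻¹ ^ n *
        ((-1) ^ n * Polynomial.aeval ((Real.sqrt l)⁻¹ * (x - y)) (Polynomial.hermite n) *
          Real.exp (-(((Real.sqrt l)⁻¹ * (x - y)) ^ 2 / 2)))) := by
  simp only [pB_eq_gaussian hl]
  rw [iteratedDeriv_const_mul_field,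
    iteratedDeriv_comp_sub_const n
      (fun z => Real.exp (-(((Real.sqrt l)⁻¹ * z) ^ 2 / 2))) y]
  have h : ContDiff ℝ n (fun z : ℝ => Real.exp (-(z ^ 2 / 2))) := by fun_prop
  simp only [iteratedDeriv_comp_const_mul h, iteratedDeriv_eq_iterate,
    Polynomial.deriv_gaussian_eq_hermite_mul_gaussian]

theorem even_deriv_heat_kernel_bound (k : ℕ) :
    ∃ c > 0, ∀ l > (0 : ℝ), ∀ x y : ℝ,
      |iteratedDeriv (2 * k) (fun x => pB l x y) x| ≤
        c * l ^ (-(k : ℤ)) * pB (2 * l) x y := by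
  obtain ⟨C, hC, hbound⟩ :=
    exists_abs_aeval_le_mul_exp_sq_div_four (Polynomial.hermite (2 * k))
  refine ⟨Real.sqrt 2 * C, by positivity, fun l hl x y => ?_⟩
  have hkernel : Real.sqrt 2 * pB (2 * l) x y = (Real.sqrt (2 * Real.pi * l))⁻¹ *
      Real.exp (-(((Real.sqrt l)⁻¹ * (x - y)) ^ 2 / 4)) := by
    have hs : Real.sqrt (2 * Real.pi * (2 * l)) = Real.sqrt 2 * Real.sqrt (2 * Real.pi * l) := by
      rw [← Real.sqrt_mul (by norm_num)]
      ring_nf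
    have he : -(x - y) ^ 2 / (2 * (2 * l)) = -(((Real.sqrt l)⁻¹ * (x - y)) ^ 2 / 4) := by
      rw [mul_pow, inv_pow, Real.sq_sqrt hl.le]
      field_simp
      norm_num
    rw [pB, hs, he]
    field_simp
  have hpow : (Real.sqrt l)⁻¹ ^ (2 * k) = l ^ (-(k : ℤ)) := by
    rw [pow_mul, inv_pow, Real.sq_sqrt hl.le, zpow_neg, zpow_natCast, inv_pow]
  rw [iteratedDeriv_pB hl, hpow]
  set u := (Real.sqrt l)⁻¹ * (x - y)
  have hexp : Real.exp (u ^ 2 / 4) * Real.exp (-(u ^ 2 / 2)) = Real.exp (-(u ^ 2 / 4)) := by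
    rw [← Real.exp_add]
    ring_nf
  have hl' : 0 < l ^ (-(k : ℤ)) := zpow_pos hl _
  calc _ = (Real.sqrt (2 * Real.pi * l))⁻¹ * (l ^ (-(k : ℤ)) *
        (|Polynomial.aeval u (Polynomial.hermite (2 * k))| * Real.exp (-(u ^ 2 / 2)))) := by
        simp [abs_mul, abs_of_pos hl, abs_of_nonneg (Real.sqrt_nonneg _)]
    _ ≤ (Real.sqrt (2 * Real.pi * l))⁻¹ * (l ^ (-(k : ℤ)) *
        (C * Real.exp (u ^ 2 / 4) * Real.exp (-(u ^ 2 / 2)))) := by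
        gcongr
        exact hbound u
    _ = C * l ^ (-(k : ℤ)) * (Real.sqrt 2 * pB (2 * l) x y) := by
        rw [hkernel, mul_assoc C, hexp]
        ring
    _ = _ := by ring
end

section
/- Fix c > 0. For every nonnegative integer k there exists a constant C_k > 0 such that for all λ > 0 and all x, y ∈ [0,∞), the 2k-th derivative in x of the Robin kernel satisfies |∂_x^{2k} p_R(λ; x, y)| ≤ C_k · λ^{−k} · p_N(2λ; x, y). -/
open Real MeasureTheory Set

/-- Half-line Neumann heat kernel. -/
noncomputable def pN (l z z' : ℝ) : ℝ :=
  (Real.exp (-(z - z') ^ 2 / (2 * l)) + Real.exp (-(z + z') ^ 2 / (2 * l))) /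
    (2 * Real.sqrt (2 * Real.pi * l))

/-- Half-line Robin heat kernel with parameter `c`. -/
noncomputable def pR (c l z z' : ℝ) : ℝ :=
  pN l z z' -
    2 * ∫ w in Set.Ioi (0 : ℝ),
      Real.exp (-w) * Real.exp (-(z + z' + w / c) ^ 2 / (2 * l)) / Real.sqrt (2 * Real.pi * l)

/-- A family of functions, each the derivative of the previous one, lists iterated derivatives. -/
theorem iteratedDeriv_eq_of_hasDerivAt_succ {f : ℕ → ℝ → ℝ}
    (hf : ∀ n x, HasDerivAt (f n) (f (n + 1) x) x) (n : ℕ) :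
    iteratedDeriv n (f 0) = f n := by
  induction n with
  | zero => exact iteratedDeriv_zero
  | succ n ih =>
    rw [iteratedDeriv_succ, ih]
    exact funext fun x => (hf n x).deriv

/-- An integer polynomial, evaluated at reals, grows more slowly than `exp (x² / 4)`. -/
theorem Polynomial.exists_abs_aeval_le_exp_sq (p : Polynomial ℤ) :
    ∃ C > 0, ∀ x : ℝ, |Polynomial.aeval x p| ≤ C * Real.exp (x ^ 2 / 4) := by
  induction p using Polynomial.induction_on' with
  | add p q hp hq =>
    obtain ⟨C, hC, hp⟩ := hp
    obtain ⟨D, hD, hq⟩ := hq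
    refine ⟨C + D, by positivity, fun x => ?_⟩
    rw [map_add, add_mul]
    exact (abs_add_le _ _).trans (add_le_add (hp x) (hq x))
  | monomial n a =>
    refine ⟨(|(a : ℝ)| + 1) * (n.factorial * Real.exp 1), by positivity, fun x => ?_⟩
    have h1 : |x| ^ n ≤ n.factorial * Real.exp |x| := by
      have h := Real.pow_div_factorial_le_exp |x| (abs_nonneg x) n
      rwa [div_le_iff₀' (by positivity)] at h
    have h2 : Real.exp |x| ≤ Real.exp 1 * Real.exp (x ^ 2 / 4) := by
      rw [← Real.exp_add]
      apply Real.exp_le_exp.mpr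
      nlinarith [sq_nonneg (|x| - 2), sq_abs x]
    have h3 : |x| ^ n ≤ n.factorial * Real.exp 1 * Real.exp (x ^ 2 / 4) := by
      rw [mul_assoc]
      exact h1.trans (by gcongr)
    rw [Polynomial.aeval_monomial, abs_mul, abs_pow, mul_assoc]
    simp only [algebraMap_int_eq, eq_intCast]
    gcongr
    linarith

theorem contDiff_exp_neg_sq_div_two {n : WithTop ℕ∞} :
    ContDiff ℝ n (fun u : ℝ => Real.exp (-(u ^ 2 / 2))) := by
  fun_prop

theorem exists_abs_iteratedDeriv_gaussian_le (n : ℕ) :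
    ∃ C > 0, ∀ u : ℝ, |iteratedDeriv n (fun u : ℝ => Real.exp (-(u ^ 2 / 2))) u| ≤
      C * Real.exp (-(u ^ 2 / 4)) := by
  obtain ⟨C, hC, h⟩ := Polynomial.exists_abs_aeval_le_exp_sq (Polynomial.hermite n)
  refine ⟨C, hC, fun u => ?_⟩
  rw [iteratedDeriv_eq_iterate, Polynomial.deriv_gaussian_eq_hermite_mul_gaussian, abs_mul,
    abs_mul, abs_pow, abs_neg, abs_one, one_pow, one_mul, Real.abs_exp]
  calc _ ≤ C * Real.exp (u ^ 2 / 4) * Real.exp (-(u ^ 2 / 2)) := by gcongr; exact h u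
    _ = _ := by rw [mul_assoc, ← Real.exp_add]; ring_nf

/-- The `n`-th derivative of `u ↦ exp (-u² / (2l))`. -/
noncomputable def gaussianDeriv (l : ℝ) (n : ℕ) (u : ℝ) : ℝ :=
  (Real.sqrt l)⁻¹ ^ n *
    iteratedDeriv n (fun u : ℝ => Real.exp (-(u ^ 2 / 2))) ((Real.sqrt l)⁻¹ * u)

theorem gaussianDeriv_zero {l : ℝ} (hl : 0 < l) (u : ℝ) :
    gaussianDeriv l 0 u = Real.exp (-u ^ 2 / (2 * l)) := by
  simp only [gaussianDeriv, pow_zero, one_mul, iteratedDeriv_zero, mul_pow, inv_pow,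
    Real.sq_sqrt hl.le]
  congr 1
  field_simp

theorem hasDerivAt_gaussianDeriv (l : ℝ) (n : ℕ) (u : ℝ) :
    HasDerivAt (gaussianDeriv l n) (gaussianDeriv l (n + 1) u) u := by
  have h := (contDiff_exp_neg_sq_div_two (n := (⊤ : ℕ∞))).differentiable_iteratedDeriv n
    (by exact_mod_cast WithTop.coe_lt_top n) ((Real.sqrt l)⁻¹ * u)
  have h1 := ((h.hasDerivAt.comp u ((hasDerivAt_id u).const_mul (Real.sqrt l)⁻¹))).const_mul
    ((Real.sqrt l)⁻¹ ^ n)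
  refine h1.congr_deriv ?_
  rw [gaussianDeriv, iteratedDeriv_succ, pow_succ]
  ring

theorem continuous_gaussianDeriv (l : ℝ) (n : ℕ) : Continuous (gaussianDeriv l n) :=
  continuous_iff_continuousAt.mpr fun u => (hasDerivAt_gaussianDeriv l n u).continuousAt

theorem exists_abs_gaussianDeriv_le (n : ℕ) :
    ∃ C > 0, ∀ l > (0 : ℝ), ∀ u : ℝ,
      |gaussianDeriv l n u| ≤ C * (Real.sqrt l)⁻¹ ^ n * Real.exp (-u ^ 2 / (2 * (2 * l))) := by
  obtain ⟨C, hC, h⟩ := exists_abs_iteratedDeriv_gaussian_le n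
  refine ⟨C, hC, fun l hl u => ?_⟩
  rw [gaussianDeriv, abs_mul, abs_of_nonneg (by positivity : 0 ≤ (Real.sqrt l)⁻¹ ^ n),
    mul_comm C, mul_assoc]
  gcongr
  refine (h _).trans_eq ?_
  rw [mul_pow, inv_pow, Real.sq_sqrt hl.le]
  congr 2
  field_simp
  norm_num

theorem exists_abs_gaussianDeriv_le_const {l : ℝ} (hl : 0 < l) (n : ℕ) :
    ∃ C, ∀ u : ℝ, |gaussianDeriv l n u| ≤ C := by
  obtain ⟨C, hC, h⟩ := exists_abs_gaussianDeriv_le n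
  refine ⟨C * (Real.sqrt l)⁻¹ ^ n, fun u => (h l hl u).trans ?_⟩
  refine mul_le_of_le_one_right (by positivity) (Real.exp_le_one_iff.mpr ?_)
  exact div_nonpos_of_nonpos_of_nonneg (neg_nonpos.mpr (sq_nonneg u)) (by positivity)

theorem integrableOn_exp_neg_mul_gaussianDeriv {l : ℝ} (hl : 0 < l) (c : ℝ) (n : ℕ) (z : ℝ) :
    Integrable (fun w => Real.exp (-w) * gaussianDeriv l n (z + w / c))
      (volume.restrict (Set.Ioi (0 : ℝ))) := by
  obtain ⟨C, h⟩ := exists_abs_gaussianDeriv_le_const hl n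
  refine Integrable.mul_bdd (c := C) (integrableOn_exp_neg_Ioi 0) ?_ (ae_of_all _ fun w => ?_)
  · exact ((continuous_gaussianDeriv l n).comp (by fun_prop)).aestronglyMeasurable
  · exact h _

theorem hasDerivAt_integral_exp_neg_mul_gaussianDeriv {l : ℝ} (hl : 0 < l) (c : ℝ) (n : ℕ)
    (z : ℝ) :
    HasDerivAt (fun z => ∫ w in Set.Ioi (0 : ℝ), Real.exp (-w) * gaussianDeriv l n (z + w / c))
      (∫ w in Set.Ioi (0 : ℝ), Real.exp (-w) * gaussianDeriv l (n + 1) (z + w / c)) z := by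
  obtain ⟨C, h⟩ := exists_abs_gaussianDeriv_le_const hl (n + 1)
  refine (hasDerivAt_integral_of_dominated_loc_of_deriv_le (s := Set.univ) (x₀ := z)
    (μ := volume.restrict (Set.Ioi (0 : ℝ)))
    (F := fun z w => Real.exp (-w) * gaussianDeriv l n (z + w / c))
    (F' := fun z w => Real.exp (-w) * gaussianDeriv l (n + 1) (z + w / c))
    (bound := fun w => Real.exp (-w) * C) Filter.univ_mem (Filter.Eventually.of_forall fun z => ?_)
    (integrableOn_exp_neg_mul_gaussianDeriv hl c n z) ?_ ?_ ?_ ?_).2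
  · exact (integrableOn_exp_neg_mul_gaussianDeriv hl c n z).aestronglyMeasurable
  · exact (integrableOn_exp_neg_mul_gaussianDeriv hl c (n + 1) z).aestronglyMeasurable
  · refine ae_of_all _ fun w z _ => ?_
    rw [norm_mul, Real.norm_of_nonneg (Real.exp_pos _).le]
    exact mul_le_mul_of_nonneg_left (h _) (Real.exp_pos _).le
  · exact (integrableOn_exp_neg_Ioi 0).mul_const C
  · refine ae_of_all _ fun w z _ => ?_
    exact ((hasDerivAt_gaussianDeriv l n (z + w / c)).comp_add_const z (w / c)).const_mul _

/-- The `n`-th derivative of the Robin kernel in its first space variable. -/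
noncomputable def robinDeriv (c l y : ℝ) (n : ℕ) (x : ℝ) : ℝ :=
  (gaussianDeriv l n (x - y) + gaussianDeriv l n (x + y)) / (2 * Real.sqrt (2 * Real.pi * l)) -
    2 * ((∫ w in Set.Ioi (0 : ℝ), Real.exp (-w) * gaussianDeriv l n (x + y + w / c)) /
      Real.sqrt (2 * Real.pi * l))

theorem robinDeriv_zero {l : ℝ} (hl : 0 < l) (c y x : ℝ) :
    robinDeriv c l y 0 x = pR c l x y := by
  simp only [robinDeriv, pR, pN, gaussianDeriv_zero hl, integral_div]

theorem hasDerivAt_robinDeriv {l : ℝ} (hl : 0 < l) (c y : ℝ) (n : ℕ) (x : ℝ) :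
    HasDerivAt (robinDeriv c l y n) (robinDeriv c l y (n + 1) x) x := by
  refine ((HasDerivAt.add ?_ ?_).div_const _).sub ((HasDerivAt.div_const ?_ _).const_mul 2)
  · exact (hasDerivAt_gaussianDeriv l n (x - y)).comp_sub_const x y
  · exact (hasDerivAt_gaussianDeriv l n (x + y)).comp_add_const x y
  · exact (hasDerivAt_integral_exp_neg_mul_gaussianDeriv hl c n (x + y)).comp_add_const x y

theorem iteratedDeriv_pR {l : ℝ} (hl : 0 < l) (c y : ℝ) (n : ℕ) :
    iteratedDeriv n (fun x => pR c l x y) = robinDeriv c l y n := by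
  rw [← iteratedDeriv_eq_of_hasDerivAt_succ (hasDerivAt_robinDeriv hl c y) n]
  congr 1
  exact funext fun x => (robinDeriv_zero hl c y x).symm

theorem abs_integral_exp_neg_mul_le {f : ℝ → ℝ} {D : ℝ} (h : ∀ w > 0, |f w| ≤ D) :
    |∫ w in Set.Ioi (0 : ℝ), Real.exp (-w) * f w| ≤ D := by
  calc |∫ w in Set.Ioi (0 : ℝ), Real.exp (-w) * f w|
      ≤ ∫ w in Set.Ioi (0 : ℝ), Real.exp (-w) * D := by
        rw [← Real.norm_eq_abs]
        refine norm_integral_le_of_norm_le ((integrableOn_exp_neg_Ioi 0).mul_const D)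
          ((ae_restrict_iff' measurableSet_Ioi).mpr (ae_of_all _ fun w hw => ?_))
        rw [norm_mul, Real.norm_of_nonneg (Real.exp_pos _).le]
        exact mul_le_mul_of_nonneg_left (h w hw) (Real.exp_pos _).le
    _ = D := by rw [integral_mul_const, integral_exp_neg_Ioi_zero, one_mul]

theorem even_deriv_robin_kernel_bound (c : ℝ) (hc : 0 < c) (k : ℕ) :
    ∃ C > 0, ∀ l > (0 : ℝ), ∀ x ∈ Set.Ici (0 : ℝ), ∀ y ∈ Set.Ici (0 : ℝ),
      |iteratedDeriv (2 * k) (fun x => pR c l x y) x| ≤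
        C * l ^ (-(k : ℤ)) * pN (2 * l) x y := by
  obtain ⟨C, hC, h⟩ := exists_abs_gaussianDeriv_le (2 * k)
  refine ⟨10 * C, by positivity, fun l hl x hx y hy => ?_⟩
  rw [Set.mem_Ici] at hx hy
  have hpow : (Real.sqrt l)⁻¹ ^ (2 * k) = l ^ (-(k : ℤ)) := by
    rw [pow_mul, inv_pow, Real.sq_sqrt hl.le, zpow_neg, zpow_natCast, inv_pow]
  have h := h l hl
  rw [hpow] at h
  set A := C * l ^ (-(k : ℤ)) with hA
  have hA0 : 0 < A := by positivity
  have hint : |∫ w in Set.Ioi (0 : ℝ), Real.exp (-w) * gaussianDeriv l (2 * k) (x + y + w / c)| ≤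
      A * Real.exp (-(x + y) ^ 2 / (2 * (2 * l))) := by
    refine abs_integral_exp_neg_mul_le fun w hw => (h _).trans ?_
    have : 0 ≤ w / c := by positivity
    have : x + y ≤ x + y + w / c := by linarith
    gcongr
  have hs : Real.sqrt (2 * Real.pi * (2 * l)) ≤ 2 * Real.sqrt (2 * Real.pi * l) := by
    rw [show 2 * Real.pi * (2 * l) = 2 * (2 * Real.pi * l) by ring,
      Real.sqrt_mul (by norm_num)]
    gcongr
    exact Real.sqrt_le_iff.mpr ⟨by norm_num, by norm_num⟩
  have hs1 : 0 < Real.sqrt (2 * Real.pi * (2 * l)) := by positivity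
  have hs2 : 0 < Real.sqrt (2 * Real.pi * l) := by positivity
  rw [iteratedDeriv_pR hl, robinDeriv, pN]
  have h1 := h (x - y)
  have h2 := h (x + y)
  set a := gaussianDeriv l (2 * k) (x - y)
  set b := gaussianDeriv l (2 * k) (x + y)
  set I := ∫ w in Set.Ioi (0 : ℝ), Real.exp (-w) * gaussianDeriv l (2 * k) (x + y + w / c)
  set E := Real.exp (-(x - y) ^ 2 / (2 * (2 * l)))
  set F := Real.exp (-(x + y) ^ 2 / (2 * (2 * l)))
  set s := Real.sqrt (2 * Real.pi * l)
  set t := Real.sqrt (2 * Real.pi * (2 * l))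
  have hE : 0 < E := Real.exp_pos _
  have hF : 0 < F := Real.exp_pos _
  calc |(a + b) / (2 * s) - 2 * (I / s)| = |a + b - 4 * I| / (2 * s) := by
        rw [← abs_of_pos (by positivity : 0 < 2 * s), ← abs_div,
          abs_of_pos (by positivity : 0 < 2 * s)]
        congr 1
        field_simp
        ring
    _ ≤ (5 * A * (E + F)) / (2 * s) := by
        gcongr
        have := mul_pos hA0 hE
        rw [abs_le] at *
        constructor <;> linarith
    _ ≤ (5 * A * (E + F)) / t := by gcongr
    _ = 10 * C * l ^ (-(k : ℤ)) * ((E + F) / (2 * t)) := by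
        rw [hA]
        field_simp
        ring
end
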